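/- For the Hadamard walk with symmetric initial qubit state φ = ᵗ[1/√2, i/√2], the quantum de Moivre–Laplace theorem holds: for all real numbers u < v, lim_{n→∞} P(u ≤ X_n^φ/n ≤ v) = ∫_u^v (1/(π(1−x²)√(1−2x²)))·1_{(−1/√2, 1/√2)}(x) dx, where 1_{(−1/√2, 1/√2)} is the indicator function of the open interval (−1/√2, 1/√2). -/

import Mathlib

open scoped BigOperators

noncomputable section

/-- The matrix `P = [[a, b], [0, 0]]`. -/
def Pm (a b : ℂ) : Matrix (Fin 2) (Fin 2) ℂ := !![a, b; 0, 0]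

/-- The matrix `Q = [[0, 0], [c, d]]`. -/
def Qm (c d : ℂ) : Matrix (Fin 2) (Fin 2) ℂ := !![0, 0; c, d]

/-- Amplitude vectors of the quantum random walk. -/
def amp (a b c d : ℂ) (φ : Fin 2 → ℂ) : ℕ → ℤ → Fin 2 → ℂ
  | 0, k => if k = 0 then φ else 0
  | n + 1, k => (Qm c d).mulVec (amp a b c d φ n (k - 1)) +
      (Pm a b).mulVec (amp a b c d φ n (k + 1))

/-- `P(Xₙ^φ = k) = ‖Ψₖ⁽ⁿ⁾(φ)‖²` (squared Euclidean norm). -/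
def qprob (a b c d : ℂ) (φ : Fin 2 → ℂ) (n : ℕ) (k : ℤ) : ℝ :=
  ∑ i, ‖amp a b c d φ n k i‖ ^ 2

open Filter

namespace HW

open MeasureTheory Complex Topology

/-- The constant `1/√2`, as a complex number. -/
def rr : ℂ := ((1 / Real.sqrt 2 : ℝ) : ℂ)

lemma rr_sq : rr * rr = 1 / 2 := by
  unfold rr
  rw [← ofReal_mul]
  have : (1 / Real.sqrt 2) * (1 / Real.sqrt 2) = 1 / 2 := by
    rw [div_mul_div_comm, Real.mul_self_sqrt (by norm_num)]; norm_num
  rw [this]; norm_num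

lemma rr_norm_sq : ‖rr‖ ^ 2 = 1 / 2 := by
  unfold rr
  rw [Complex.norm_real, Real.norm_eq_abs, sq_abs, div_pow, Real.sq_sqrt (by norm_num)]
  norm_num

/-- The Hadamard amplitudes. -/
def ha (n : ℕ) (k : ℤ) : Fin 2 → ℂ := amp rr rr rr (-rr) ![rr, I * rr] n k

lemma ha_zero (k : ℤ) : ha 0 k = if k = 0 then ![rr, I * rr] else 0 := rfl

lemma ha_succ_zero (n : ℕ) (k : ℤ) :
    ha (n + 1) k 0 = rr * (ha n (k + 1) 0 + ha n (k + 1) 1) := by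
  simp [ha, amp, Pm, Qm, dotProduct, Fin.sum_univ_two]
  ring

lemma ha_succ_one (n : ℕ) (k : ℤ) :
    ha (n + 1) k 1 = rr * (ha n (k - 1) 0 - ha n (k - 1) 1) := by
  simp [ha, amp, Pm, Qm, dotProduct, Fin.sum_univ_two]
  ring

lemma ha_supp (n : ℕ) : ∀ k : ℤ, k ∉ Finset.Icc (-(n : ℤ)) n → ha n k = 0 := by
  induction n with
  | zero =>
    intro k hk
    rw [ha_zero, if_neg]
    rintro rfl
    simp at hk
  | succ n ih =>
    intro k hk
    simp only [Finset.mem_Icc, not_and_or, not_le] at hk ih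
    have h1 := ih (k + 1)
    have h2 := ih (k - 1)
    push_cast at hk
    ext i
    fin_cases i
    · change ha (n + 1) k 0 = 0
      rw [ha_succ_zero, h1 (by omega)]; simp
    · change ha (n + 1) k 1 = 0
      rw [ha_succ_one, h2 (by omega)]; simp

/-- The character `exp (i x)`. -/
def ee (x : ℝ) : ℂ := Complex.exp (x * I)

lemma ee_add (x y : ℝ) : ee (x + y) = ee x * ee y := by
  simp [ee, add_mul, Complex.exp_add]

lemma ee_norm (x : ℝ) : ‖ee x‖ = 1 := Complex.norm_exp_ofReal_mul_I x

lemma ee_cont : Continuous ee := by unfold ee; fun_prop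

lemma ee_conj (x : ℝ) : (starRingEnd ℂ) (ee x) = ee (-x) := by
  simp [ee, ← Complex.exp_conj]

lemma ee_eq (x : ℝ) : ee x = (Real.cos x : ℂ) + (Real.sin x : ℂ) * I := by
  simp [ee, Complex.exp_mul_I]

/-- Fourier transform of the walk. -/
def F : ℕ → ℝ → ℂ × ℂ
  | 0, _ => (rr, I * rr)
  | n + 1, θ => (ee (-θ) * rr * ((F n θ).1 + (F n θ).2), ee θ * rr * ((F n θ).1 - (F n θ).2))

lemma F_cont (n : ℕ) : Continuous (F n) := by
  induction n with
  | zero => exact continuous_const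
  | succ n ih =>
    have := ee_cont
    simp only [F]
    fun_prop

lemma F_norm (n : ℕ) (θ : ℝ) : ‖(F n θ).1‖ ^ 2 + ‖(F n θ).2‖ ^ 2 = 1 := by
  induction n with
  | zero => simp only [F, norm_mul, mul_pow, rr_norm_sq, norm_I]; norm_num
  | succ n ih =>
    simp only [F, norm_mul, mul_pow, rr_norm_sq, ee_norm]
    have := parallelogram_law_with_norm ℝ (F n θ).1 (F n θ).2
    linarith

lemma F_hasSum (n : ℕ) (θ : ℝ) :
    HasSum (fun k : ℤ => ha n k 0 * ee (k * θ)) (F n θ).1 ∧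
    HasSum (fun k : ℤ => ha n k 1 * ee (k * θ)) (F n θ).2 := by
  induction n with
  | zero =>
    constructor
    · change HasSum _ rr
      convert hasSum_ite_eq (0 : ℤ) rr using 2 with k
      rw [ha_zero]
      split_ifs with h <;> simp [h, ee]
    · change HasSum _ (I * rr)
      convert hasSum_ite_eq (0 : ℤ) (I * rr) using 2 with k
      rw [ha_zero]
      split_ifs with h <;> simp [h, ee]
  | succ n ih =>
    obtain ⟨h0, h1⟩ := ih
    constructor
    · have := ((Equiv.addRight (1 : ℤ)).hasSum_iff).2 ((h0.add h1).mul_left (ee (-θ) * rr))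
      refine this.congr_fun ?_
      intro k
      simp only [Function.comp, Equiv.coe_addRight, ha_succ_zero]
      have : ee (k * θ) = ee (-θ) * ee ((k + 1 : ℤ) * θ) := by
        rw [← ee_add]; congr 1; push_cast; ring
      rw [this]; ring
    · have := ((Equiv.subRight (1 : ℤ)).hasSum_iff).2 ((h0.sub h1).mul_left (ee θ * rr))
      refine this.congr_fun ?_
      intro k
      simp only [Function.comp, Equiv.subRight_apply, ha_succ_one]
      have : ee (k * θ) = ee θ * ee ((k - 1 : ℤ) * θ) := by
        rw [← ee_add]; congr 1; push_cast; ring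
      rw [this]; ring

lemma F_eq0 (n : ℕ) (θ : ℝ) :
    (F n θ).1 = ∑ k ∈ Finset.Icc (-(n : ℤ)) n, ha n k 0 * ee (k * θ) :=
  (F_hasSum n θ).1.unique (hasSum_sum_of_ne_finset_zero fun k hk => by simp [ha_supp n k hk])

lemma F_eq1 (n : ℕ) (θ : ℝ) :
    (F n θ).2 = ∑ k ∈ Finset.Icc (-(n : ℤ)) n, ha n k 1 * ee (k * θ) :=
  (F_hasSum n θ).2.unique (hasSum_sum_of_ne_finset_zero fun k hk => by simp [ha_supp n k hk])

lemma integral_ee (m : ℤ) :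
    ∫ θ in (-Real.pi)..Real.pi, ee (m * θ) = if m = 0 then (2 * Real.pi : ℂ) else 0 := by
  split_ifs with h
  · subst h
    simp [ee]; ring
  · have hm : (m : ℂ) * I ≠ 0 := mul_ne_zero (by exact_mod_cast h) I_ne_zero
    have : ∀ θ : ℝ, ee (m * θ) = Complex.exp ((m : ℂ) * I * θ) := by
      intro θ; simp only [ee]; congr 1; push_cast; ring
    simp_rw [this]
    rw [integral_exp_mul_complex hm]
    have : Complex.exp ((m : ℂ) * I * (Real.pi : ℝ)) = Complex.exp ((m : ℂ) * I * ((-Real.pi : ℝ) : ℂ)) := by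
      rw [Complex.exp_eq_exp_iff_exists_int]
      exact ⟨m, by push_cast; ring⟩
    rw [this]; simp

/-- Parseval identity for trigonometric polynomials with shift. -/
lemma parseval (s : Finset ℤ) (c : ℤ → ℂ) (t : ℝ) :
    ∫ θ in (-Real.pi)..Real.pi, (starRingEnd ℂ) (∑ k ∈ s, c k * ee (k * θ)) *
      (∑ k ∈ s, c k * ee (k * (θ + t))) =
    2 * Real.pi * ∑ k ∈ s, ((‖c k‖ ^ 2 : ℝ) : ℂ) * ee (k * t) := by
  have hc := ee_cont
  have h : ∀ θ : ℝ, (starRingEnd ℂ) (∑ k ∈ s, c k * ee (k * θ)) *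
      (∑ k ∈ s, c k * ee (k * (θ + t))) =
      ∑ k ∈ s, ∑ l ∈ s, ((starRingEnd ℂ) (c k) * c l * ee (l * t)) * ee ((l - k : ℤ) * θ) := by
    intro θ
    rw [map_sum, Finset.sum_mul_sum]
    refine Finset.sum_congr rfl fun k _ => Finset.sum_congr rfl fun l _ => ?_
    rw [map_mul, ee_conj]
    have h1 : ee (l * (θ + t)) = ee (l * θ) * ee (l * t) := by rw [← ee_add]; congr 1; ring
    have h2 : ee ((l - k : ℤ) * θ) = ee (l * θ) * ee (-(k * θ)) := by
      rw [← ee_add]; congr 1; push_cast; ring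
    rw [h1, h2]; ring
  simp_rw [h]
  rw [intervalIntegral.integral_finsetSum]
  · rw [Finset.mul_sum]
    refine Finset.sum_congr rfl fun k hk => ?_
    rw [intervalIntegral.integral_finsetSum]
    · simp_rw [intervalIntegral.integral_const_mul, integral_ee]
      rw [Finset.sum_eq_single k]
      · simp only [sub_self, if_true]
        rw [← Complex.normSq_eq_conj_mul_self, Complex.normSq_eq_norm_sq]
        ring
      · intro l _ hl
        rw [if_neg (sub_ne_zero.2 hl)]; simp
      · intro h; exact absurd hk h
    · intro l _
      apply Continuous.intervalIntegrable
      fun_prop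
  · intro k _
    apply Continuous.intervalIntegrable
    fun_prop

/-- Inner product. -/
def G (n : ℕ) (θ θ' : ℝ) : ℂ :=
  (starRingEnd ℂ) (F n θ).1 * (F n θ').1 + (starRingEnd ℂ) (F n θ).2 * (F n θ').2

def qp (n : ℕ) (k : ℤ) : ℝ := qprob rr rr rr (-rr) ![rr, I * rr] n k

lemma qp_eq (n : ℕ) (k : ℤ) : qp n k = ‖ha n k 0‖ ^ 2 + ‖ha n k 1‖ ^ 2 := by
  simp [qp, qprob, ha, Fin.sum_univ_two]

lemma qp_nonneg (n : ℕ) (k : ℤ) : 0 ≤ qp n k := by rw [qp_eq]; positivity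

lemma qp_supp (n : ℕ) (k : ℤ) (hk : k ∉ Finset.Icc (-(n : ℤ)) n) : qp n k = 0 := by
  rw [qp_eq, ha_supp n k hk]; simp

lemma G_norm (n : ℕ) (θ θ' : ℝ) : ‖G n θ θ'‖ ≤ 2 := by
  have h1 := F_norm n θ
  have h2 := F_norm n θ'
  refine (norm_add_le _ _).trans ?_
  simp only [norm_mul, RCLike.norm_conj]
  nlinarith [sq_nonneg (‖(F n θ).1‖ - ‖(F n θ').1‖), sq_nonneg (‖(F n θ).2‖ - ‖(F n θ').2‖)]

lemma char_eq (n : ℕ) (t : ℝ) :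
    ∑ k ∈ Finset.Icc (-(n : ℤ)) n, (qp n k : ℂ) * ee (k * t) =
      (2 * Real.pi : ℂ)⁻¹ * ∫ θ in (-Real.pi)..Real.pi, G n θ (θ + t) := by
  have hF := F_cont n
  have e : ∫ θ in (-Real.pi)..Real.pi, G n θ (θ + t) =
      2 * Real.pi * ∑ k ∈ Finset.Icc (-(n : ℤ)) n, (qp n k : ℂ) * ee (k * t) := by
    unfold G
    rw [intervalIntegral.integral_add]
    · simp_rw [F_eq0, F_eq1]
      rw [parseval, parseval, ← mul_add, ← Finset.sum_add_distrib]
      congr 1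
      refine Finset.sum_congr rfl fun k _ => ?_
      rw [qp_eq]; push_cast; ring
    · apply Continuous.intervalIntegrable
      fun_prop
    · apply Continuous.intervalIntegrable
      fun_prop
  rw [e, inv_mul_cancel_left₀]
  exact mul_ne_zero two_ne_zero (by exact_mod_cast Real.pi_ne_zero)

lemma qp_sum (n : ℕ) : ∑ k ∈ Finset.Icc (-(n : ℤ)) n, qp n k = 1 := by
  have h := char_eq n 0
  have hG : ∀ θ, G n θ (θ + 0) = 1 := by
    intro θ
    rw [add_zero, G, ← Complex.normSq_eq_conj_mul_self, ← Complex.normSq_eq_conj_mul_self,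
      Complex.normSq_eq_norm_sq, Complex.normSq_eq_norm_sq, ← ofReal_add, F_norm]; simp
  have hp : (Real.pi : ℂ) ≠ 0 := by exact_mod_cast Real.pi_ne_zero
  simp_rw [hG] at h
  have h3 : (2 * Real.pi : ℂ)⁻¹ * (∫ θ in (-Real.pi)..Real.pi, (1 : ℂ)) = 1 := by
    simp; field_simp; norm_num
  rw [h3] at h
  simp [ee] at h
  exact_mod_cast h

/-- `sin θ / √2`. -/
def TT (θ : ℝ) : ℝ := Real.sin θ * (1 / Real.sqrt 2)

/-- The phase. -/
def om (θ : ℝ) : ℝ := Real.arcsin (TT θ)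

/-- Cosine of the phase. -/
def CC (θ : ℝ) : ℝ := Real.sqrt (1 - TT θ ^ 2)

lemma TT_sq (θ : ℝ) : TT θ ^ 2 = Real.sin θ ^ 2 / 2 := by
  unfold TT
  rw [mul_pow, div_pow, Real.sq_sqrt (by norm_num)]; ring

lemma TT_sq_le (θ : ℝ) : TT θ ^ 2 ≤ 1 / 2 := by
  rw [TT_sq]; nlinarith [Real.sin_sq_add_cos_sq θ, sq_nonneg (Real.cos θ)]

lemma CC_sq (θ : ℝ) : CC θ ^ 2 = 1 - TT θ ^ 2 :=
  Real.sq_sqrt (by linarith [TT_sq_le θ])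

lemma CC_pos (θ : ℝ) : 0 < CC θ := Real.sqrt_pos.2 (by linarith [TT_sq_le θ])

lemma TT_mem (θ : ℝ) : -1 < TT θ ∧ TT θ < 1 :=
  abs_lt.1 ((sq_lt_one_iff_abs_lt_one _).1 (by linarith [TT_sq_le θ]))

lemma sin_om (θ : ℝ) : Real.sin (om θ) = TT θ :=
  Real.sin_arcsin (TT_mem θ).1.le (TT_mem θ).2.le

lemma cos_om (θ : ℝ) : Real.cos (om θ) = CC θ := Real.cos_arcsin _

lemma TT_cont : Continuous TT := by unfold TT; fun_prop

lemma CC_cont : Continuous CC := by have := TT_cont; unfold CC; fun_prop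

/-- First component of the reflected initial state. -/
def p0 (θ : ℝ) : ℂ := (Real.cos θ + Real.sin θ + I * Real.cos θ) / (2 * CC θ)

/-- Second component of the reflected initial state. -/
def p1 (θ : ℝ) : ℂ := (Real.cos θ + I * (Real.sin θ - Real.cos θ)) / (2 * CC θ)

lemma CC_ne (θ : ℝ) : (CC θ : ℂ) ≠ 0 := by exact_mod_cast (CC_pos θ).ne'

lemma p0_cont : Continuous p0 := by
  have := CC_cont
  unfold p0
  refine Continuous.div (by fun_prop) (by fun_prop) fun θ => ?_
  exact mul_ne_zero two_ne_zero (CC_ne θ)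

lemma p1_cont : Continuous p1 := by
  have := CC_cont
  unfold p1
  refine Continuous.div (by fun_prop) (by fun_prop) fun θ => ?_
  exact mul_ne_zero two_ne_zero (CC_ne θ)

lemma TT_c (θ : ℝ) : (TT θ : ℂ) = Real.sin θ * rr := by
  unfold TT rr; push_cast; rfl

lemma CC_sq_c (θ : ℝ) : (CC θ : ℂ) ^ 2 = 1 - (Real.sin θ : ℂ) ^ 2 / 2 := by
  have := CC_sq θ
  rw [TT_sq] at this
  exact_mod_cast this

lemma sc (θ : ℝ) : (Real.cos θ : ℂ) ^ 2 = 1 - (Real.sin θ : ℂ) ^ 2 := by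
  have := Real.cos_sq' θ
  exact_mod_cast this

lemma ee_neg_eq (x : ℝ) : ee (-x) = (Real.cos x : ℂ) - (Real.sin x : ℂ) * I := by
  rw [ee_eq]; simp only [Real.cos_neg, Real.sin_neg, ofReal_neg]; ring

lemma stepφ0 (θ : ℝ) : ee (-θ) * rr * (rr + I * rr) = CC θ * p0 θ - I * TT θ * rr := by
  have h := CC_ne θ
  rw [ee_neg_eq, TT_c, p0]
  generalize (Real.cos θ : ℂ) = c at *
  generalize (Real.sin θ : ℂ) = s at *
  generalize (CC θ : ℂ) = C at *
  field_simp
  linear_combination (2 * c - 2 * s * I + 2 * c * I - 2 * s * I ^ 2 + 2 * I * s) * rr_sq - s * Complex.I_sq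

lemma stepφ1 (θ : ℝ) : ee θ * rr * (rr - I * rr) = CC θ * p1 θ - I * TT θ * (I * rr) := by
  have h := CC_ne θ
  rw [ee_eq, TT_c, p1]
  generalize (Real.cos θ : ℂ) = c at *
  generalize (Real.sin θ : ℂ) = s at *
  generalize (CC θ : ℂ) = C at *
  field_simp
  linear_combination (2 * (c + s * I) * (1 - I) + 2 * I ^ 2 * s) * rr_sq

lemma stepψ0 (θ : ℝ) : ee (-θ) * rr * (p0 θ + p1 θ) = CC θ * rr - I * TT θ * p0 θ := by
  have h := CC_ne θ
  have h2 := CC_sq_c θ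
  have h3 := sc θ
  rw [ee_neg_eq, TT_c, p0, p1]
  generalize (Real.cos θ : ℂ) = c at *
  generalize (Real.sin θ : ℂ) = s at *
  generalize (CC θ : ℂ) = C at *
  field_simp
  linear_combination rr * (2 * h3 - 2 * h2 + (c * s - s ^ 2) * Complex.I_sq)

lemma stepψ1 (θ : ℝ) : ee θ * rr * (p0 θ - p1 θ) = CC θ * (I * rr) - I * TT θ * p1 θ := by
  have h := CC_ne θ
  have h2 := CC_sq_c θ
  have h3 := sc θ
  rw [ee_eq, TT_c, p0, p1]
  generalize (Real.cos θ : ℂ) = c at *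
  generalize (Real.sin θ : ℂ) = s at *
  generalize (CC θ : ℂ) = C at *
  field_simp
  linear_combination rr * (I * (2 * h3 - 2 * h2) + c * s * Complex.I_sq)

lemma cos_succ_om (n : ℕ) (θ : ℝ) : Real.cos ((n + 1 : ℕ) * om θ) =
    Real.cos (n * om θ) * CC θ - Real.sin (n * om θ) * TT θ := by
  rw [← cos_om, ← sin_om, ← Real.cos_add]; congr 1; push_cast; ring

lemma sin_succ_om (n : ℕ) (θ : ℝ) : Real.sin ((n + 1 : ℕ) * om θ) =
    Real.sin (n * om θ) * CC θ + Real.cos (n * om θ) * TT θ := by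
  rw [← cos_om, ← sin_om, ← Real.sin_add]; congr 1; push_cast; ring

lemma F_closed (n : ℕ) (θ : ℝ) :
    (Even n → F n θ = (Real.cos (n * om θ) * rr - I * Real.sin (n * om θ) * p0 θ,
      Real.cos (n * om θ) * (I * rr) - I * Real.sin (n * om θ) * p1 θ)) ∧
    (Odd n → F n θ = (Real.cos (n * om θ) * p0 θ - I * Real.sin (n * om θ) * rr,
      Real.cos (n * om θ) * p1 θ - I * Real.sin (n * om θ) * (I * rr))) := by
  induction n with
  | zero => simp [F]
  | succ n ih =>
    have a := stepφ0 θ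
    have b := stepφ1 θ
    have c := stepψ0 θ
    have d := stepψ1 θ
    rw [cos_succ_om, sin_succ_om]
    have hi := Complex.I_sq
    push_cast
    push_cast at ih
    generalize Complex.cos (n * om θ) = x at *
    generalize Complex.sin (n * om θ) = y at *
    constructor
    · intro hn
      have hn' : Odd n := by
        rw [Nat.even_add_one, Nat.not_even_iff_odd] at hn; exact hn
      rw [F, ih.2 hn']
      ext
      · simp only
        linear_combination x * c - I * y * a + y * TT θ * rr * hi
      · simp only
        linear_combination x * d - I * y * b + y * TT θ * I * rr * hi
    · intro hn
      have hn' : Even n := by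
        rw [Nat.odd_add_one, Nat.not_odd_iff_even] at hn; exact hn
      rw [F, ih.1 hn']
      ext
      · simp only
        linear_combination x * a - I * y * c + y * TT θ * p0 θ * hi
      · simp only
        linear_combination x * b - I * y * d + y * TT θ * p1 θ * hi

/-- Overlap of reflected states. -/
def AA (θ θ' : ℝ) : ℂ := (starRingEnd ℂ) (p0 θ) * p0 θ' + (starRingEnd ℂ) (p1 θ) * p1 θ'

def BB (θ : ℝ) : ℝ := TT θ / CC θ

lemma rr_conj : (starRingEnd ℂ) rr = rr := conj_ofReal _

lemma BB_eq (θ : ℝ) : rr * p0 θ - I * rr * p1 θ = BB θ := by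
  have h := CC_ne θ
  rw [BB, ofReal_div, TT_c, p0, p1]
  generalize (Real.cos θ : ℂ) = c at *
  generalize (Real.sin θ : ℂ) = s at *
  generalize (CC θ : ℂ) = C at *
  field_simp
  linear_combination rr * (c - s) * Complex.I_sq

lemma BB_eq' (θ : ℝ) : (starRingEnd ℂ) (p0 θ) * rr + (starRingEnd ℂ) (p1 θ) * (I * rr) = BB θ := by
  have := congrArg (starRingEnd ℂ) (BB_eq θ)
  simp only [map_sub, map_mul, rr_conj, conj_I, conj_ofReal] at this
  linear_combination this

lemma AA_self (θ : ℝ) : AA θ θ = 1 := by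
  have h := CC_ne θ
  have h2 := CC_sq_c θ
  have h3 := sc θ
  have hi := Complex.I_sq
  simp only [AA, p0, p1, map_div₀, map_add, map_mul, map_sub, conj_I, conj_ofReal, map_ofNat]
  generalize (Real.cos θ : ℂ) = c at *
  generalize (Real.sin θ : ℂ) = s at *
  generalize (CC θ : ℂ) = C at *
  field_simp
  linear_combination (-4) * h2 + 4 * h3 + (-c ^ 2 - (s - c) ^ 2) * hi

lemma G_close (n : ℕ) (θ θ' : ℝ) :
    ‖G n θ θ' - ((Real.cos (n * om θ' - n * om θ) : ℝ) -
      I * BB θ * (Real.sin (n * om θ' - n * om θ) : ℝ))‖ ≤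
      ‖AA θ θ' - 1‖ + ‖(BB θ' : ℂ) - BB θ‖ := by
  have hc := Real.abs_cos_le_one (n * om θ)
  have hs := Real.abs_sin_le_one (n * om θ)
  have hc' := Real.abs_cos_le_one (n * om θ')
  have hs' := Real.abs_sin_le_one (n * om θ')
  have key : ∀ (a b : ℝ) (z w : ℂ) (d : ℝ), |a| ≤ 1 → |b| ≤ 1 → |d| ≤ 1 →
      ∀ ε : ℂ, ‖ε‖ = 1 → ‖(a : ℂ) * b * z + ε * d * b * w‖ ≤ ‖z‖ + ‖w‖ := by
    intro a b z w d ha hb hd ε he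
    refine (norm_add_le _ _).trans ?_
    simp only [norm_mul, he, Complex.norm_real, Real.norm_eq_abs, one_mul]
    have h1 : |a| * |b| ≤ 1 := mul_le_one₀ ha (abs_nonneg _) hb
    have h2 : |d| * |b| ≤ 1 := mul_le_one₀ hd (abs_nonneg _) hb
    exact add_le_add (mul_le_of_le_one_left (norm_nonneg _) h1)
      (mul_le_of_le_one_left (norm_nonneg _) h2)
  have hB := BB_eq θ
  have hB' := BB_eq θ'
  have hBc := BB_eq' θ
  have hi := Complex.I_sq
  have hr := rr_sq
  rw [Real.cos_sub, Real.sin_sub]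
  rcases Nat.even_or_odd n with hn | hn
  · have e1 := (F_closed n θ).1 hn
    have e2 := (F_closed n θ').1 hn
    have := key _ _ (AA θ θ' - 1) ((BB θ' : ℂ) - BB θ) _ hs hs' hc (-I) (by simp)
    convert this using 2
    rw [G, e1, e2, AA]
    simp only [map_sub, map_mul, conj_I, conj_ofReal, rr_conj]
    generalize Real.cos (n * om θ) = c
    generalize Real.cos (n * om θ') = c'
    generalize Real.sin (n * om θ) = s
    generalize Real.sin (n * om θ') = s'
    push_cast
    linear_combination (c : ℂ) * c' * ((1 - I ^ 2) * hr - hi / 2) - I * c * s' * hB' +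
      I * s * c' * hBc - s * s' * ((starRingEnd ℂ) (p0 θ) * p0 θ' + (starRingEnd ℂ) (p1 θ) * p1 θ') * hi
  · have e1 := (F_closed n θ).2 hn
    have e2 := (F_closed n θ').2 hn
    have := key _ _ (AA θ θ' - 1) ((BB θ' : ℂ) - BB θ) _ hc hc' hs I (by simp)
    convert this using 2
    rw [G, e1, e2, AA]
    simp only [map_sub, map_mul, conj_I, conj_ofReal, rr_conj]
    generalize Real.cos (n * om θ) = c
    generalize Real.cos (n * om θ') = c'
    generalize Real.sin (n * om θ) = s
    generalize Real.sin (n * om θ') = s'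
    push_cast
    linear_combination (s : ℂ) * s' * ((I ^ 4 - I ^ 2) * hr + (I ^ 2 - 2) / 2 * hi) -
      (I * c * s' * hBc - I * s * c' * hB')

def hh (θ : ℝ) : ℝ := Real.cos θ / Real.sqrt (1 + Real.cos θ ^ 2)

lemma hh_cont : Continuous hh := by
  unfold hh
  refine Continuous.div (by fun_prop) (by fun_prop) fun θ => ?_
  exact (Real.sqrt_pos.2 (by positivity)).ne'

lemma om_deriv (θ : ℝ) : HasDerivAt om (hh θ) θ := by
  have h1 : HasDerivAt TT (Real.cos θ * (1 / Real.sqrt 2)) θ :=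
    (Real.hasDerivAt_sin θ).mul_const _
  have h2 := (Real.hasDerivAt_arcsin (TT_mem θ).1.ne' (TT_mem θ).2.ne).comp θ h1
  refine h2.congr_deriv ?_
  have : Real.sqrt (1 + Real.cos θ ^ 2) = Real.sqrt (1 - TT θ ^ 2) * Real.sqrt 2 := by
    rw [← Real.sqrt_mul (by linarith [TT_sq_le θ]), TT_sq]
    congr 1
    linarith [Real.sin_sq_add_cos_sq θ]
  rw [hh, this]
  have h3 : 0 < Real.sqrt (1 - TT θ ^ 2) := CC_pos θ
  field_simp

/-- Limit integrand. -/
def KK (ξ θ : ℝ) : ℂ := (Real.cos (ξ * hh θ) : ℝ) - I * BB θ * (Real.sin (ξ * hh θ) : ℝ)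

lemma BB_cont : Continuous BB := TT_cont.div CC_cont fun θ => (CC_pos θ).ne'

lemma shift_tendsto (θ ξ : ℝ) : Tendsto (fun n : ℕ => θ + ξ / n) atTop (𝓝 θ) := by
  have := (tendsto_const_div_atTop_nhds_zero_nat ξ).const_add θ
  simpa using this

lemma phase_tendsto (θ ξ : ℝ) :
    Tendsto (fun n : ℕ => n * om (θ + ξ / n) - n * om θ) atTop (𝓝 (ξ * hh θ)) := by
  have h := (om_deriv θ).hasFDerivAt.lim ξ (c := fun n : ℕ => (n : ℝ)) (l := atTop)
    (by simpa using tendsto_natCast_atTop_atTop (R := ℝ))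
  refine (h.congr fun n => ?_).trans_eq ?_
  · simp only [smul_eq_mul]
    rw [show (n : ℝ)⁻¹ * ξ = ξ / n by ring]; ring
  · simp

lemma G_tendsto (θ ξ : ℝ) :
    Tendsto (fun n : ℕ => G n θ (θ + ξ / n)) atTop (𝓝 (KK ξ θ)) := by
  have hsh := shift_tendsto θ ξ
  have hA : Continuous (fun θ' => ‖AA θ θ' - 1‖ + ‖(BB θ' : ℂ) - BB θ‖) := by
    have := p0_cont
    have := p1_cont
    have := BB_cont
    unfold AA
    fun_prop
  have hA' := (hA.tendsto θ).comp hsh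
  simp only [AA_self, sub_self, norm_zero, add_zero] at hA'
  have h0 := squeeze_zero_norm (fun n : ℕ => G_close n θ (θ + ξ / n)) hA'
  have hc : Continuous (fun x : ℝ => ((Real.cos x : ℝ) : ℂ) - I * BB θ * (Real.sin x : ℝ)) := by
    fun_prop
  have h1 := (hc.tendsto _).comp (phase_tendsto θ ξ)
  have := h0.add h1
  simpa [KK, Function.comp_def] using this

lemma KK_cont (ξ : ℝ) : Continuous (KK ξ) := by
  have := BB_cont
  have := hh_cont
  unfold KK
  fun_prop

lemma int_tendsto (ξ : ℝ) :
    Tendsto (fun n : ℕ => ∫ θ in (-Real.pi)..Real.pi, G n θ (θ + ξ / n)) atTop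
      (𝓝 (∫ θ in (-Real.pi)..Real.pi, KK ξ θ)) := by
  refine intervalIntegral.tendsto_integral_filter_of_dominated_convergence (fun _ => 2) ?_ ?_ ?_ ?_
  · refine Eventually.of_forall fun n => Continuous.aestronglyMeasurable ?_
    have := F_cont n
    unfold G
    fun_prop
  · exact Eventually.of_forall fun n => ae_of_all _ fun θ _ => G_norm n _ _
  · exact intervalIntegrable_const
  · exact ae_of_all _ fun θ _ => G_tendsto θ ξ

lemma hh_neg (θ : ℝ) : hh (-θ) = hh θ := by simp [hh]

lemma hh_pi_sub (θ : ℝ) : hh (Real.pi - θ) = -hh θ := by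
  simp [hh, Real.cos_pi_sub, neg_div]

lemma BB_neg (θ : ℝ) : BB (-θ) = -BB θ := by
  simp [BB, CC, TT, neg_div]

lemma KK_integral (ξ : ℝ) : ∫ θ in (-Real.pi)..Real.pi, KK ξ θ =
    2 * ∫ θ in (0 : ℝ)..Real.pi, ee (ξ * hh θ) := by
  have hK := KK_cont ξ
  have hh' := hh_cont
  have h1 : ∫ θ in (-Real.pi)..(0 : ℝ), KK ξ θ = ∫ θ in (0 : ℝ)..Real.pi, KK ξ (-θ) := by
    rw [intervalIntegral.integral_comp_neg (fun θ => KK ξ θ)]; simp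
  rw [← intervalIntegral.integral_add_adjacent_intervals (b := 0)
    (hK.intervalIntegrable _ _) (hK.intervalIntegrable _ _), h1,
    ← intervalIntegral.integral_add (f := fun θ => KK ξ (-θ))
      ((hK.comp continuous_neg).intervalIntegrable _ _) (hK.intervalIntegrable _ _)]
  have h2 : ∀ θ, KK ξ (-θ) + KK ξ θ = 2 * ((Real.cos (ξ * hh θ) : ℝ) : ℂ) := by
    intro θ
    simp only [KK, hh_neg, BB_neg, ofReal_neg]; ring
  simp_rw [h2]
  rw [intervalIntegral.integral_const_mul]
  congr 1
  have h3 : ∫ θ in (0 : ℝ)..Real.pi, Real.sin (ξ * hh θ) = 0 := by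
    have := intervalIntegral.integral_comp_sub_left (a := 0) (b := Real.pi)
      (fun θ => Real.sin (ξ * hh θ)) Real.pi
    simp only [hh_pi_sub, mul_neg, Real.sin_neg, sub_self, sub_zero,
      intervalIntegral.integral_neg] at this
    linarith
  simp_rw [ee_eq]
  rw [intervalIntegral.integral_add, intervalIntegral.integral_mul_const,
    intervalIntegral.integral_ofReal (f := fun θ => Real.sin (ξ * hh θ)), h3]
  · simp
  · apply Continuous.intervalIntegrable; fun_prop
  · apply Continuous.intervalIntegrable; fun_prop

/-- Law of the rescaled walk. -/
def mun (n : ℕ) : Measure ℝ :=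
  ∑ k ∈ Finset.Icc (-(n : ℤ)) n, ENNReal.ofReal (qp n k) • Measure.dirac ((k : ℝ) / n)

instance mun_prob (n : ℕ) : IsProbabilityMeasure (mun n) := by
  constructor
  simp only [mun, Measure.coe_finsetSum, Finset.sum_apply, Measure.smul_apply, measure_univ,
    smul_eq_mul, mul_one]
  rw [← ENNReal.ofReal_sum_of_nonneg fun k _ => qp_nonneg n k, qp_sum, ENNReal.ofReal_one]

lemma mun_charFun (n : ℕ) (ξ : ℝ) : charFun (mun n) ξ =
    ∑ k ∈ Finset.Icc (-(n : ℤ)) n, (qp n k : ℂ) * ee (k * (ξ / n)) := by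
  rw [charFun_apply_real, mun, integral_finsetSum_measure]
  · refine Finset.sum_congr rfl fun k _ => ?_
    rw [integral_smul_measure, integral_dirac, ENNReal.toReal_ofReal (qp_nonneg n k), ee,
      Complex.real_smul]
    congr 2
    push_cast; ring
  · intro k _
    refine Integrable.smul_measure ?_ ENNReal.ofReal_ne_top
    exact integrable_dirac (by simp)

lemma mun_real (n : ℕ) (u v : ℝ) : (mun n (Set.Icc u v)).toReal =
    ∑' k : ℤ, if u ≤ (k : ℝ) / (n : ℝ) ∧ (k : ℝ) / (n : ℝ) ≤ v then qp n k else 0 := by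
  classical
  rw [tsum_eq_sum (s := Finset.Icc (-(n : ℤ)) n)]
  · simp only [mun, Measure.coe_finsetSum, Finset.sum_apply, Measure.smul_apply,
      smul_eq_mul]
    rw [ENNReal.toReal_sum]
    · refine Finset.sum_congr rfl fun k _ => ?_
      rw [Measure.dirac_apply' _ measurableSet_Icc, Set.indicator_apply]
      simp only [Set.mem_Icc]
      split_ifs
      · simp [qp_nonneg]
      · simp
    · intro k _
      exact ENNReal.mul_ne_top ENNReal.ofReal_ne_top (measure_ne_top _ _)
  · intro k hk
    simp [qp_supp n k hk]

/-- The limit law. -/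
def nu : Measure ℝ :=
  ENNReal.ofReal (1 / Real.pi) • (volume.restrict (Set.Ioo 0 Real.pi)).map hh

instance nu_prob : IsProbabilityMeasure nu := by
  constructor
  rw [nu, Measure.smul_apply, Measure.map_apply hh_cont.measurable MeasurableSet.univ]
  simp only [Set.preimage_univ, Measure.restrict_apply_univ, Real.volume_Ioo, sub_zero, smul_eq_mul]
  rw [← ENNReal.ofReal_mul (by positivity), one_div_mul_cancel Real.pi_ne_zero, ENNReal.ofReal_one]

lemma nu_charFun (ξ : ℝ) : charFun nu ξ =
    (2 * Real.pi : ℂ)⁻¹ * ∫ θ in (-Real.pi)..Real.pi, KK ξ θ := by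
  rw [KK_integral, charFun_apply_real, nu, integral_smul_measure,
    integral_map hh_cont.aemeasurable (by fun_prop), ENNReal.toReal_ofReal (by positivity),
    intervalIntegral.integral_of_le Real.pi_pos.le, integral_Ioc_eq_integral_Ioo,
    Complex.real_smul]
  have hp : (Real.pi : ℂ) ≠ 0 := by exact_mod_cast Real.pi_ne_zero
  have : ∀ x, ee (ξ * hh x) = Complex.exp (ξ * hh x * I) := by
    intro x; simp [ee]
  simp_rw [this]
  generalize (∫ x in Set.Ioo 0 Real.pi, Complex.exp (ξ * hh x * I)) = J
  push_cast
  field_simp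

lemma charFun_tendsto (ξ : ℝ) :
    Tendsto (fun n => charFun (mun n) ξ) atTop (𝓝 (charFun nu ξ)) := by
  rw [nu_charFun]
  simp_rw [mun_charFun, char_eq]
  exact (int_tendsto ξ).const_mul _

lemma hh_injOn : Set.InjOn hh (Set.Ioo 0 Real.pi) := by
  intro x hx y hy hxy
  apply Real.injOn_cos ⟨hx.1.le, hx.2.le⟩ ⟨hy.1.le, hy.2.le⟩
  have key : ∀ c : ℝ, c = (c / Real.sqrt (1 + c ^ 2)) / Real.sqrt (1 - (c / Real.sqrt (1 + c ^ 2)) ^ 2) := by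
    intro c
    have h0 : (0 : ℝ) < 1 + c ^ 2 := by positivity
    have : 1 - (c / Real.sqrt (1 + c ^ 2)) ^ 2 = 1 / (1 + c ^ 2) := by
      rw [div_pow, Real.sq_sqrt h0.le]; field_simp; ring
    rw [this, Real.sqrt_div zero_le_one, Real.sqrt_one]
    have := Real.sqrt_pos.2 h0
    field_simp
  rw [key (Real.cos x), key (Real.cos y)]
  unfold hh at hxy
  rw [hxy]

lemma nu_apply (s : Set ℝ) (hs : MeasurableSet s) :
    nu s = ENNReal.ofReal (1 / Real.pi) * volume (hh ⁻¹' s ∩ Set.Ioo 0 Real.pi) := by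
  rw [nu, Measure.smul_apply, Measure.map_apply hh_cont.measurable hs,
    Measure.restrict_apply (hh_cont.measurable hs), smul_eq_mul]

lemma nu_singleton (x : ℝ) : nu {x} = 0 := by
  rw [nu_apply _ (measurableSet_singleton x)]
  have : (hh ⁻¹' {x} ∩ Set.Ioo 0 Real.pi).Subsingleton := by
    rintro a ⟨ha, ha'⟩ b ⟨hb, hb'⟩
    exact hh_injOn ha' hb' (ha.trans hb.symm)
  rw [this.measure_zero, mul_zero]

/-- `mun` as a probability measure. -/
def munP (n : ℕ) : ProbabilityMeasure ℝ := ⟨mun n, mun_prob n⟩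

/-- `nu` as a probability measure. -/
def nuP : ProbabilityMeasure ℝ := ⟨nu, nu_prob⟩

lemma measure_tendsto (u v : ℝ) (huv : u < v) :
    Tendsto (fun n => (mun n (Set.Icc u v)).toReal) atTop (𝓝 (nu (Set.Icc u v)).toReal) := by
  have h : Tendsto munP atTop (𝓝 nuP) :=
    ProbabilityMeasure.tendsto_iff_tendsto_charFun.2 charFun_tendsto
  have h2 := ProbabilityMeasure.tendsto_measure_of_null_frontier_of_tendsto' h
    (E := Set.Icc u v) (by
      rw [frontier_Icc huv.le]
      refine measure_mono_null (t := {u} ∪ {v}) (by intro x; simp [or_comm]) ?_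
      exact measure_union_null (nu_singleton u) (nu_singleton v))
  exact (ENNReal.tendsto_toReal (measure_ne_top nu _)).comp h2

lemma hh_deriv (θ : ℝ) : HasDerivAt hh
    (-Real.sin θ / ((1 + Real.cos θ ^ 2) * Real.sqrt (1 + Real.cos θ ^ 2))) θ := by
  have h0 : (0 : ℝ) < 1 + Real.cos θ ^ 2 := by positivity
  have h1 := (((Real.hasDerivAt_cos θ).pow 2).const_add 1).sqrt h0.ne'
  have h2 := (Real.hasDerivAt_cos θ).div h1 (Real.sqrt_pos.2 h0).ne'
  refine h2.congr_deriv ?_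
  have h3 := Real.sqrt_pos.2 h0
  have h4 := Real.sq_sqrt h0.le
  generalize Real.sqrt (1 + Real.cos θ ^ 2) = q at *
  rw [← h4]
  field_simp
  rw [h4]
  norm_num
  ring

lemma hh_image (u v : ℝ) : hh '' (hh ⁻¹' Set.Icc u v ∩ Set.Ioo 0 Real.pi) =
    Set.Icc u v ∩ Set.Ioo (-(1 / Real.sqrt 2)) (1 / Real.sqrt 2) := by
  have h2 : (1 / Real.sqrt 2) ^ 2 = 1 / 2 := by rw [div_pow, Real.sq_sqrt (by norm_num)]; norm_num
  have h2p : 0 < 1 / Real.sqrt 2 := by positivity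
  ext x
  constructor
  · rintro ⟨θ, ⟨h, hθ⟩, rfl⟩
    refine ⟨h, ?_⟩
    rw [Set.mem_Ioo, ← abs_lt]
    apply abs_lt_of_sq_lt_sq _ h2p.le
    have h0 : (0 : ℝ) < 1 + Real.cos θ ^ 2 := by positivity
    rw [h2, hh, div_pow, Real.sq_sqrt h0.le, div_lt_div_iff₀ h0 (by norm_num)]
    have := Real.sin_pos_of_pos_of_lt_pi hθ.1 hθ.2
    nlinarith [Real.sin_sq_add_cos_sq θ]
  · rintro ⟨h, hx⟩
    rw [Set.mem_Ioo, ← abs_lt] at hx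
    have hx2 : x ^ 2 < 1 / 2 := by
      rw [← h2]; exact sq_lt_sq' (abs_lt.1 hx).1 (abs_lt.1 hx).2
    have hp : 0 < 1 - x ^ 2 := by linarith
    have hs := Real.sqrt_pos.2 hp
    have hq : (x / Real.sqrt (1 - x ^ 2)) ^ 2 < 1 := by
      rw [div_pow, Real.sq_sqrt hp.le, div_lt_one hp]; linarith
    have hq' := abs_lt.1 ((sq_lt_one_iff_abs_lt_one _).1 hq)
    have hc : Real.cos (Real.arccos (x / Real.sqrt (1 - x ^ 2))) = x / Real.sqrt (1 - x ^ 2) :=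
      Real.cos_arccos hq'.1.le hq'.2.le
    have hx' : hh (Real.arccos (x / Real.sqrt (1 - x ^ 2))) = x := by
      rw [hh, hc]
      have : 1 + (x / Real.sqrt (1 - x ^ 2)) ^ 2 = 1 / (1 - x ^ 2) := by
        rw [div_pow, Real.sq_sqrt hp.le]; field_simp; ring
      rw [this, Real.sqrt_div zero_le_one, Real.sqrt_one]
      field_simp
    refine ⟨_, ⟨?_, ?_, ?_⟩, hx'⟩
    · rw [Set.mem_preimage, hx']; exact h
    · exact Real.arccos_pos.2 hq'.2
    · exact Real.arccos_lt_pi.2 hq'.1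

def dens (x : ℝ) : ℝ := 1 / (Real.pi * (1 - x ^ 2) * Real.sqrt (1 - 2 * x ^ 2))

lemma nu_integral (u v : ℝ) (huv : u < v) : (nu (Set.Icc u v)).toReal =
    ∫ x in u..v, Set.indicator (Set.Ioo (-(1 / Real.sqrt 2)) (1 / Real.sqrt 2)) dens x := by
  rw [intervalIntegral.integral_of_le huv.le, ← integral_Icc_eq_integral_Ioc,
    setIntegral_indicator measurableSet_Ioo, ← hh_image,
    integral_image_eq_integral_abs_deriv_smul
      ((hh_cont.measurable measurableSet_Icc).inter measurableSet_Ioo)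
      (fun x _ => (hh_deriv x).hasDerivWithinAt) (hh_injOn.mono Set.inter_subset_right)]
  rw [setIntegral_congr_fun (g := fun _ => 1 / Real.pi)
    ((hh_cont.measurable measurableSet_Icc).inter measurableSet_Ioo)]
  · rw [nu_apply _ measurableSet_Icc, setIntegral_const, ENNReal.toReal_mul,
      ENNReal.toReal_ofReal (by positivity), smul_eq_mul, mul_comm]
    rfl
  · rintro θ ⟨_, hθ⟩
    have hs := Real.sin_pos_of_pos_of_lt_pi hθ.1 hθ.2
    have h0 : (0 : ℝ) < 1 + Real.cos θ ^ 2 := by positivity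
    have hq := Real.sqrt_pos.2 h0
    have e1 : 1 - hh θ ^ 2 = 1 / (1 + Real.cos θ ^ 2) := by
      rw [hh, div_pow, Real.sq_sqrt h0.le]; field_simp; ring
    have e2 : Real.sqrt (1 - 2 * hh θ ^ 2) = Real.sin θ / Real.sqrt (1 + Real.cos θ ^ 2) := by
      have : 1 - 2 * hh θ ^ 2 = Real.sin θ ^ 2 / (1 + Real.cos θ ^ 2) := by
        rw [hh, div_pow, Real.sq_sqrt h0.le, Real.sin_sq]; field_simp; ring
      rw [this, Real.sqrt_div (sq_nonneg _), Real.sqrt_sq hs.le]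
    simp only [dens, smul_eq_mul]
    rw [e1, e2, neg_div, abs_neg, abs_of_pos (by positivity)]
    have := Real.pi_pos
    field_simp

end HW

theorem hadamard_quantum_de_moivre_laplace (u v : ℝ) (huv : u < v) :
    Tendsto
      (fun n : ℕ => ∑' k : ℤ,
        if u ≤ (k : ℝ) / (n : ℝ) ∧ (k : ℝ) / (n : ℝ) ≤ v then
          qprob ((1 / Real.sqrt 2 : ℝ) : ℂ) ((1 / Real.sqrt 2 : ℝ) : ℂ)
            ((1 / Real.sqrt 2 : ℝ) : ℂ) (-((1 / Real.sqrt 2 : ℝ) : ℂ))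
            ![((1 / Real.sqrt 2 : ℝ) : ℂ), Complex.I * ((1 / Real.sqrt 2 : ℝ) : ℂ)] n k
        else 0)
      atTop
      (nhds (∫ x in u..v,
        Set.indicator (Set.Ioo (-(1 / Real.sqrt 2)) (1 / Real.sqrt 2))
          (fun x => 1 / (Real.pi * (1 - x ^ 2) * Real.sqrt (1 - 2 * x ^ 2))) x)) := by
  have h := HW.measure_tendsto u v huv
  rw [HW.nu_integral u v huv] at h
  simp_rw [HW.mun_real] at h
  exact h
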